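/- For all ℓ ≥ 2 and n ≥ 1, the number I(ℓ, n) of irreducible n-partitions of Fin ℓ satisfies the recurrence I(ℓ, n) = S(ℓ−1, n) + Σ_{j=0}^{ℓ−2} Σ_{m=0}^{n−2} S(j, m) · I(ℓ−j−1, n−m) · (n−m−1). -/

import Mathlib

/-- An `n`-partition of `Fin ℓ` is reducible if some nonempty proper subset of its blocks
has union `{i : Fin ℓ | (i : ℕ) < j}` for some `1 ≤ j < ℓ`. -/
def Reducible {ℓ : ℕ} (P : Finpartition (Finset.univ : Finset (Fin ℓ))) : Prop :=
  ∃ j : ℕ, 1 ≤ j ∧ j < ℓ ∧ ∃ B : Finset (Finset (Fin ℓ)),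
    B.Nonempty ∧ B ⊂ P.parts ∧ B.sup id = Finset.univ.filter (fun i : Fin ℓ => (i : ℕ) < j)

/-- `S ℓ n`: the number of `n`-partitions of `Fin ℓ` (Stirling number of the second kind). -/
noncomputable def S (ℓ n : ℕ) : ℕ :=
  Nat.card {P : Finpartition (Finset.univ : Finset (Fin ℓ)) // P.parts.card = n}

/-- `I ℓ n`: the number of irreducible `n`-partitions of `Fin ℓ`. -/
noncomputable def I (ℓ n : ℕ) : ℕ :=
  Nat.card {P : Finpartition (Finset.univ : Finset (Fin ℓ)) // P.parts.card = n ∧ ¬ Reducible P}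

/-- Number of classes. -/
noncomputable def ncl {α : Type} (r : Setoid α) : ℕ := Nat.card (Quotient r)

/-- `k` is a cut of `r`. -/
def Cut {L : ℕ} (r : Setoid (Fin L)) (k : ℕ) : Prop :=
  ∀ x y : Fin L, r x y → x.val < k → y.val < k

/-- No nontrivial cut. -/
def Irr {L : ℕ} (r : Setoid (Fin L)) : Prop :=
  ∀ k, 1 ≤ k → k < L → ¬ Cut r k

instance finite_setoid (L : ℕ) : Finite (Setoid (Fin L)) :=
  Finite.of_injective (fun r : Setoid (Fin L) => (fun x y => r x y)) (by
    intro r s h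
    ext x y
    exact iff_of_eq (congrFun (congrFun h x) y))

noncomputable instance fintype_setoid (L : ℕ) : Fintype (Setoid (Fin L)) := Fintype.ofFinite _

/-- The setoid of a partition. -/
def toS {L : ℕ} (P : Finpartition (Finset.univ : Finset (Fin L))) : Setoid (Fin L) :=
  Setoid.ker P.part

theorem toS_rel {L : ℕ} (P : Finpartition (Finset.univ : Finset (Fin L))) (x y : Fin L) :
    toS P x y ↔ P.part x = P.part y := Iff.rfl

theorem toS_bij (L : ℕ) : Function.Bijective (toS (L := L)) := by
  classical
  constructor
  · intro P Q h
    have hp : ∀ x, P.part x = Q.part x := by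
      intro x
      ext y
      have : toS P y x ↔ toS Q y x := by rw [h]
      rw [toS_rel, toS_rel, ← P.mem_part_iff_part_eq_part (by simp) (by simp),
        ← Q.mem_part_iff_part_eq_part (by simp) (by simp)] at this
      exact this
    ext t
    constructor
    · intro ht
      obtain ⟨x, -, hx⟩ := P.part_surjOn ht
      rw [← hx, hp]; simp
    · intro ht
      obtain ⟨x, -, hx⟩ := Q.part_surjOn ht
      rw [← hx, ← hp]; simp
  · intro r
    refine ⟨Finpartition.ofSetoid r, ?_⟩
    ext x y
    rw [toS_rel, ← Finpartition.mem_part_iff_part_eq_part _ (by simp) (by simp),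
      Finpartition.mem_part_ofSetoid_iff_rel]
    exact ⟨fun h => r.symm h, fun h => r.symm h⟩

theorem ncl_ker {α β : Type} (f : α → β) (hf : Function.Surjective f) :
    ncl (Setoid.ker f) = Nat.card β :=
  Nat.card_congr (Setoid.quotientKerEquivOfSurjective f hf)

theorem ncl_toS {L : ℕ} (P : Finpartition (Finset.univ : Finset (Fin L))) :
    ncl (toS P) = P.parts.card := by
  have h : toS P = Setoid.ker (fun x => (⟨P.part x, by simp⟩ : P.parts)) := by
    ext x y
    rw [toS_rel, Setoid.ker_def, Subtype.mk.injEq]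
  rw [h, ncl_ker]
  · simp
  · intro t
    obtain ⟨x, -, hx⟩ := P.part_surjOn t.2
    exact ⟨x, Subtype.ext hx⟩

theorem red_iff {L : ℕ} (P : Finpartition (Finset.univ : Finset (Fin L))) :
    ¬ Reducible P ↔ Irr (toS P) := by
  classical
  rw [not_iff_comm]
  unfold Irr
  push Not
  constructor
  · rintro ⟨j, h1, h2, hc⟩
    have key : ∀ x : Fin L, x.val < j → ∀ y ∈ P.part x, y.val < j := by
      intro x hx y hy
      refine hc x y ?_ hx
      rw [toS_rel, eq_comm, ← P.mem_part_iff_part_eq_part (by simp) (by simp)]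
      exact hy
    refine ⟨j, h1, h2, P.parts.filter (fun t => ∀ x ∈ t, x.val < j), ?_, ?_, ?_⟩
    · refine ⟨P.part ⟨0, by omega⟩, ?_⟩
      rw [Finset.mem_filter]
      exact ⟨by simp, key _ (show 0 < j by omega)⟩
    · rw [Finset.filter_ssubset]
      refine ⟨P.part ⟨j, h2⟩, by simp, ?_⟩
      intro h
      have := h ⟨j, h2⟩ (P.mem_part (by simp))
      simp at this
    · ext x
      simp only [Finset.mem_sup, Finset.mem_filter, id, Finset.mem_univ, true_and]
      constructor
      · rintro ⟨t, ⟨_, ht⟩, hx⟩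
        exact ht x hx
      · intro hx
        exact ⟨P.part x, ⟨by simp, key x hx⟩, P.mem_part (by simp)⟩
  · rintro ⟨j, h1, h2, B, hB, hs, hsup⟩
    refine ⟨j, h1, h2, ?_⟩
    intro x y hxy hx
    have hx' : x ∈ B.sup id := by rw [hsup]; simpa using hx
    rw [Finset.mem_sup] at hx'
    obtain ⟨t, ht, hxt⟩ := hx'
    have hy : y ∈ B.sup id := by
      rw [Finset.mem_sup]
      refine ⟨t, ht, ?_⟩
      have := P.part_eq_of_mem (hs.1 ht) hxt
      rw [toS_rel] at hxy
      show y ∈ t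
      rw [← this, hxy]
      exact P.mem_part (by simp)
    rw [hsup] at hy
    simpa using hy

theorem S_eq (L n : ℕ) : S L n = Nat.card {r : Setoid (Fin L) // ncl r = n} :=
  Nat.card_congr ((Equiv.ofBijective _ (toS_bij L)).subtypeEquiv
    (fun P => by simp [ncl_toS]))

theorem I_eq (L n : ℕ) : I L n = Nat.card {r : Setoid (Fin L) // ncl r = n ∧ Irr r} :=
  Nat.card_congr ((Equiv.ofBijective _ (toS_bij L)).subtypeEquiv
    (fun P => by simp [ncl_toS, red_iff]))

/-- attach a last point to the class `c` -/
noncomputable def attF {L : ℕ} (Q : Setoid (Fin L)) (c : Quotient Q) (x : Fin (L + 1)) : Quotient Q :=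
  if h : x.val < L then Quotient.mk Q ⟨x.val, h⟩ else c

noncomputable def att {L : ℕ} (Q : Setoid (Fin L)) (c : Quotient Q) : Setoid (Fin (L + 1)) :=
  Setoid.ker (attF Q c)

theorem att_rel {L : ℕ} (Q : Setoid (Fin L)) (c : Quotient Q) (x y) :
    att Q c x y ↔ attF Q c x = attF Q c y := Iff.rfl

@[simp] theorem attF_cast {L : ℕ} (Q : Setoid (Fin L)) (c : Quotient Q) (x : Fin L) :
    attF Q c x.castSucc = Quotient.mk Q x := by simp [attF]

@[simp] theorem attF_last {L : ℕ} (Q : Setoid (Fin L)) (c : Quotient Q) :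
    attF Q c (Fin.last L) = c := by simp [attF]

theorem ncl_att {L : ℕ} (Q : Setoid (Fin L)) (c : Quotient Q) : ncl (att Q c) = ncl Q := by
  unfold att
  rw [ncl_ker]; rfl
  intro d
  obtain ⟨x, rfl⟩ := Quotient.exists_rep d
  exact ⟨x.castSucc, by simp⟩

/-- initial classes -/
def Ini {L : ℕ} (r : Setoid (Fin L)) (c : Quotient r) : Prop :=
  ∀ i, 1 ≤ i → Cut r i → ∃ x : Fin L, x.val < i ∧ Quotient.mk r x = c

theorem irr_att {L : ℕ} (Q : Setoid (Fin L)) (c : Quotient Q) : Irr (att Q c) ↔ Ini Q c := by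
  constructor
  · intro h i hi hc
    by_contra hne
    push Not at hne
    obtain ⟨z, hz⟩ := Quotient.exists_rep c
    have hiL : i < L + 1 := by
      by_contra hh
      exact hne z (by omega) hz
    refine h i hi hiL ?_
    intro x y hxy hx
    rw [att_rel] at hxy
    induction x using Fin.lastCases with
    | last => simp at hx; omega
    | cast x =>
      induction y using Fin.lastCases with
      | last => 
        simp at hxy
        exact absurd hxy (hne x (by simpa using hx))
      | cast y =>
        simp only [attF_cast] at hxy
        exact hc x y (Quotient.exact hxy) hx
  · intro h k h1 h2 hc
    obtain ⟨x, hx, hxc⟩ := h k h1 (by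
      intro x y hxy hx
      refine hc x.castSucc y.castSucc ?_ hx
      rw [att_rel]
      simpa using Quotient.sound hxy)
    have := hc x.castSucc (Fin.last L) (by rw [att_rel]; simpa using hxc) hx
    simp at this
    omega

theorem att_inj {L : ℕ} (Q Q' : Setoid (Fin L)) (c : Quotient Q) (c' : Quotient Q')
    (h : att Q c = att Q' c') : (⟨Q, c⟩ : Σ Q : Setoid (Fin L), Quotient Q) = ⟨Q', c'⟩ := by
  have h1 : Q = Q' := by
    ext x y
    have : att Q c x.castSucc y.castSucc ↔ att Q' c' x.castSucc y.castSucc := by rw [h]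
    simp only [att_rel, attF_cast, Quotient.eq] at this
    exact this
  subst h1
  obtain ⟨x, rfl⟩ := Quotient.exists_rep c
  have : att Q (Quotient.mk Q x) x.castSucc (Fin.last L) := by rw [att_rel]; simp
  rw [h, att_rel] at this
  simp only [attF_cast, attF_last] at this
  rw [this]

theorem att_surj {L : ℕ} (hL : 1 ≤ L) (P : Setoid (Fin (L + 1))) (hP : Irr P) :
    ∃ Q c, att (L := L) Q c = P := by
  have h := hP L hL (by omega)
  unfold Cut at h
  push Not at h
  obtain ⟨x, y, hxy, hx, hy⟩ := h
  have hy' : y = Fin.last L := by ext; simp; omega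
  subst hy'
  obtain ⟨x, rfl⟩ : ∃ z : Fin L, x = z.castSucc := ⟨⟨x, hx⟩, rfl⟩
  refine ⟨Setoid.comap Fin.castSucc P, Quotient.mk _ x, ?_⟩
  ext a b
  rw [att_rel]
  induction a using Fin.lastCases with
  | last =>
    induction b using Fin.lastCases with
    | last => simp
    | cast b =>
      simp only [attF_cast, attF_last, Quotient.eq, Setoid.comap_rel]
      exact ⟨fun h => P.trans (P.symm hxy) h, fun h => P.trans hxy h⟩
  | cast a =>
    induction b using Fin.lastCases with
    | last =>
      simp only [attF_cast, attF_last, Quotient.eq, Setoid.comap_rel]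
      exact ⟨fun h => P.trans h hxy, fun h => P.trans h (P.symm hxy)⟩
    | cast b => simp only [attF_cast, Quotient.eq, Setoid.comap_rel]

noncomputable def nb {L : ℕ} (r : Setoid (Fin L)) : ℕ := Nat.card {c : Quotient r // Ini r c}

open Classical in
theorem I_succ (L n : ℕ) (hL : 1 ≤ L) :
    I (L + 1) n = ∑ r : Setoid (Fin L) with ncl r = n, nb r := by
  rw [I_eq]
  have e : (Σ Q : {Q : Setoid (Fin L) // ncl Q = n}, {c : Quotient Q.1 // Ini Q.1 c}) ≃
      {r : Setoid (Fin (L + 1)) // ncl r = n ∧ Irr r} := by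
    refine Equiv.ofBijective
      (fun p => ⟨att p.1.1 p.2.1, by rw [ncl_att]; exact p.1.2, (irr_att _ _).2 p.2.2⟩) ⟨?_, ?_⟩
    · rintro ⟨⟨Q, hQ⟩, ⟨c, hc⟩⟩ ⟨⟨Q', hQ'⟩, ⟨c', hc'⟩⟩ h
      have := att_inj _ _ _ _ (congrArg Subtype.val h)
      simp only [Sigma.mk.injEq] at this
      obtain ⟨h1, h2⟩ := this
      subst h1
      have := eq_of_heq h2
      subst this
      rfl
    · rintro ⟨P, hP, hi⟩
      obtain ⟨Q, c, rfl⟩ := att_surj hL P hi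
      exact ⟨⟨⟨Q, by rw [← ncl_att Q c]; exact hP⟩, ⟨c, (irr_att _ _).1 hi⟩⟩, rfl⟩
  rw [← Nat.card_congr e, Nat.card_sigma, Finset.sum_subtype (p := fun r => ncl r = n) _ (by simp)]
  rfl

/-- glue two setoids -/
noncomputable def gluF {L k j : ℕ} (h : k + j = L) (A : Setoid (Fin k)) (B : Setoid (Fin j))
    (x : Fin L) : Quotient A ⊕ Quotient B :=
  if hx : x.val < k then Sum.inl (Quotient.mk A ⟨x.val, hx⟩)
  else Sum.inr (Quotient.mk B ⟨x.val - k, by omega⟩)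

noncomputable def glu {L k j : ℕ} (h : k + j = L) (A : Setoid (Fin k)) (B : Setoid (Fin j)) :
    Setoid (Fin L) := Setoid.ker (gluF h A B)

def lft {L k j : ℕ} (h : k + j = L) (x : Fin k) : Fin L := ⟨x.val, by omega⟩
def rgt {L k j : ℕ} (h : k + j = L) (x : Fin j) : Fin L := ⟨k + x.val, by omega⟩

theorem lr_cases {L k j : ℕ} (h : k + j = L) (x : Fin L) :
    (∃ y : Fin k, x = lft h y) ∨ (∃ y : Fin j, x = rgt h y) := by
  by_cases hx : x.val < k
  · exact Or.inl ⟨⟨x.val, hx⟩, rfl⟩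
  · refine Or.inr ⟨⟨x.val - k, by omega⟩, ?_⟩
    ext
    simp only [rgt]
    omega

section
variable {L k j : ℕ} (h : k + j = L) (A : Setoid (Fin k)) (B : Setoid (Fin j))

theorem glu_rel (x y : Fin L) : glu h A B x y ↔ gluF h A B x = gluF h A B y := Iff.rfl

@[simp] theorem gluF_lft (x : Fin k) : gluF h A B (lft h x) = Sum.inl (Quotient.mk A x) := by
  simp [gluF, lft]

@[simp] theorem gluF_rgt (x : Fin j) : gluF h A B (rgt h x) = Sum.inr (Quotient.mk B x) := by
  simp [gluF, rgt]

theorem gluF_surj : Function.Surjective (gluF h A B) := by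
  rintro (a | b)
  · obtain ⟨x, rfl⟩ := Quotient.exists_rep a
    exact ⟨lft h x, by simp⟩
  · obtain ⟨x, rfl⟩ := Quotient.exists_rep b
    exact ⟨rgt h x, by simp⟩

theorem ncl_glu : ncl (glu h A B) = ncl A + ncl B := by
  unfold glu
  rw [ncl_ker _ (gluF_surj h A B), Nat.card_sum]
  rfl

theorem glu_cut_self : Cut (glu h A B) k := by
  intro x y hxy hx
  rw [glu_rel] at hxy
  by_contra hy
  simp [gluF, hx, hy] at hxy

theorem glu_cut_of {i : ℕ} (hc : Cut (glu h A B) i) : Cut A i := by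
  intro x y hxy hx
  refine hc (lft h x) (lft h y) ?_ hx
  rw [glu_rel]
  simpa [Quotient.eq] using hxy

theorem nb_glu (hk : 1 ≤ k) (hA : Irr A) : nb (glu h A B) = ncl A := by
  let e : Quotient (glu h A B) ≃ Quotient A ⊕ Quotient B :=
    Setoid.quotientKerEquivOfSurjective _ (gluF_surj h A B)
  have he : ∀ x, e (Quotient.mk _ x) = gluF h A B x := fun x => rfl
  refine (Nat.card_congr (Equiv.ofBijective
    (fun a : Quotient A => (⟨e.symm (Sum.inl a), ?_⟩ :
      {c : Quotient (glu h A B) // Ini (glu h A B) c})) ⟨?_, ?_⟩)).symm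
  · intro i hi hc
    obtain ⟨x, rfl⟩ := Quotient.exists_rep a
    have hki : k ≤ i := by
      by_contra hlt
      exact hA i hi (by omega) (glu_cut_of h A B hc)
    refine ⟨lft h x, by simp only [lft]; omega, ?_⟩
    rw [Equiv.eq_symm_apply, he, gluF_lft]
  · intro a b hab
    exact Sum.inl_injective (e.symm.injective (congrArg Subtype.val hab))
  · rintro ⟨c, hc⟩
    obtain ⟨x, hx, rfl⟩ := hc k hk (glu_cut_self h A B)
    refine ⟨Quotient.mk A ⟨x.val, hx⟩, ?_⟩
    apply Subtype.ext
    show e.symm _ = _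
    rw [Equiv.symm_apply_eq, he]
    simp [gluF, hx]

theorem glu_comap_left : Setoid.comap (lft h) (glu h A B) = A := by
  ext x y
  rw [Setoid.comap_rel, glu_rel]
  simp [Quotient.eq]

theorem glu_comap_right : Setoid.comap (rgt h) (glu h A B) = B := by
  ext x y
  rw [Setoid.comap_rel, glu_rel]
  simp [Quotient.eq]

theorem glu_comap (r : Setoid (Fin L)) (hr : Cut r k) :
    glu h (Setoid.comap (lft h) r) (Setoid.comap (rgt h) r) = r := by
  have hno : ∀ (x : Fin k) (y : Fin j), ¬ r (lft h x) (rgt h y) := by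
    intro x y hxy
    have := hr _ _ hxy x.2
    simp [rgt] at this
  ext x y
  rw [glu_rel]
  rcases lr_cases h x with ⟨x, rfl⟩ | ⟨x, rfl⟩ <;> rcases lr_cases h y with ⟨y, rfl⟩ | ⟨y, rfl⟩
  · simp [Quotient.eq, Setoid.comap_rel]
  · simp [hno]
  · simpa using fun hh => hno y x (r.symm hh)
  · simp [Quotient.eq, Setoid.comap_rel]

end

/-- first cut -/
def FC {L : ℕ} (r : Setoid (Fin L)) (k : ℕ) : Prop :=
  1 ≤ k ∧ Cut r k ∧ ∀ i, 1 ≤ i → i < k → ¬ Cut r i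

theorem FC_unique {L : ℕ} (r : Setoid (Fin L)) (k k' : ℕ) (h : FC r k) (h' : FC r k') : k = k' := by
  rcases lt_trichotomy k k' with hlt | heq | hlt
  · exact absurd h.2.1 (h'.2.2 k h.1 hlt)
  · exact heq
  · exact absurd h'.2.1 (h.2.2 k' h'.1 hlt)

theorem FC_exists {L : ℕ} (hL : 1 ≤ L) (r : Setoid (Fin L)) : ∃ k, k ≤ L ∧ FC r k := by
  classical
  have hex : ∃ k, 1 ≤ k ∧ Cut r k := ⟨L, hL, fun x y _ _ => y.2⟩
  refine ⟨Nat.find hex, Nat.find_min' hex ⟨hL, fun x y _ _ => y.2⟩, (Nat.find_spec hex).1,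
    (Nat.find_spec hex).2, ?_⟩
  intro i hi hik hc
  exact Nat.find_min hex hik ⟨hi, hc⟩

theorem FC_glu {L k j : ℕ} (h : k + j = L) (hk : 1 ≤ k) (A : Setoid (Fin k)) (B : Setoid (Fin j))
    (hA : Irr A) : FC (glu h A B) k :=
  ⟨hk, glu_cut_self h A B, fun i hi hik hc => hA i hi hik (glu_cut_of h A B hc)⟩

theorem FC_irr {L k j : ℕ} (h : k + j = L) (r : Setoid (Fin L)) (hr : FC r k) :
    Irr (Setoid.comap (lft h) r) := by
  intro i hi hik hc
  refine hr.2.2 i hi hik ?_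
  intro x y hxy hx
  have hx' : x.val < k := by omega
  have hy' := hr.2.1 x y hxy hx'
  exact hc ⟨x, hx'⟩ ⟨y, hy'⟩ hxy hx

theorem ncl_pos {k : ℕ} (hk : 1 ≤ k) (A : Setoid (Fin k)) : 1 ≤ ncl A := by
  have : Nonempty (Quotient A) := ⟨Quotient.mk A ⟨0, hk⟩⟩
  exact Nat.card_pos

open Classical in
theorem glu_inner_sum (w : ℕ → ℕ) {L k j : ℕ} (h : k + j = L) (hk : 1 ≤ k) (n : ℕ) :
    ∑ r : Setoid (Fin L) with ncl r = n ∧ FC r k, w (nb r) =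
      ∑ m ∈ Finset.range n, S j m * I k (n - m) * w (n - m) := by
  have h1 : ∑ r : Setoid (Fin L) with ncl r = n ∧ FC r k, w (nb r) =
      ∑ p : Setoid (Fin j) × Setoid (Fin k) with ncl p.2 + ncl p.1 = n ∧ Irr p.2, w (ncl p.2) := by
    symm
    refine Finset.sum_bij' (fun p _ => glu h p.2 p.1)
      (fun r _ => (Setoid.comap (rgt h) r, Setoid.comap (lft h) r)) ?_ ?_ ?_ ?_ ?_
    · rintro ⟨B, A⟩ hp
      simp only [Finset.mem_filter, Finset.mem_univ, true_and] at hp ⊢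
      exact ⟨by rw [ncl_glu]; exact hp.1, FC_glu h hk A B hp.2⟩
    · intro r hr
      simp only [Finset.mem_filter, Finset.mem_univ, true_and] at hr ⊢
      refine ⟨?_, FC_irr h r hr.2⟩
      rw [← ncl_glu h, glu_comap h r hr.2.2.1]
      exact hr.1
    · rintro ⟨B, A⟩ hp
      simp only [glu_comap_left, glu_comap_right]
    · intro r hr
      simp only [Finset.mem_filter, Finset.mem_univ, true_and] at hr
      exact glu_comap h r hr.2.2.1
    · rintro ⟨B, A⟩ hp
      simp only [Finset.mem_filter, Finset.mem_univ, true_and] at hp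
      simp only [nb_glu h A B hk hp.2]
  rw [h1]
  rw [← Finset.sum_fiberwise_of_maps_to (t := Finset.range n) (g := fun p => ncl p.1)]
  · refine Finset.sum_congr rfl ?_
    intro m hm
    rw [Finset.mem_range] at hm
    have hset : (Finset.univ.filter (fun p : Setoid (Fin j) × Setoid (Fin k) =>
        ncl p.2 + ncl p.1 = n ∧ Irr p.2)).filter (fun p => ncl p.1 = m) =
        (Finset.univ.filter (fun r : Setoid (Fin j) => ncl r = m)) ×ˢ
        (Finset.univ.filter (fun r : Setoid (Fin k) => ncl r = n - m ∧ Irr r)) := by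
      ext ⟨B, A⟩
      simp only [Finset.mem_filter, Finset.mem_univ, true_and, Finset.mem_product]
      constructor
      · rintro ⟨⟨h1, h2⟩, h3⟩
        exact ⟨h3, by omega, h2⟩
      · rintro ⟨h3, h1, h2⟩
        exact ⟨⟨by omega, h2⟩, h3⟩
    rw [hset, Finset.sum_congr rfl (g := fun _ => w (n - m))]
    · rw [Finset.sum_const, Finset.card_product, S_eq, I_eq, smul_eq_mul,
        Nat.card_eq_fintype_card, Nat.card_eq_fintype_card, Fintype.card_subtype,
        Fintype.card_subtype]
    · rintro ⟨B, A⟩ hp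
      simp only [Finset.mem_filter, Finset.mem_univ, true_and, Finset.mem_product] at hp
      simp only [hp.2.1]
  · rintro ⟨B, A⟩ hp
    simp only [Finset.mem_filter, Finset.mem_univ, true_and, Finset.mem_range] at hp ⊢
    have := ncl_pos hk A
    omega

open Classical in
theorem glu_outer_sum (w : ℕ → ℕ) (L n : ℕ) (hL : 1 ≤ L) :
    ∑ r : Setoid (Fin L) with ncl r = n, w (nb r) =
      ∑ j ∈ Finset.range L, ∑ m ∈ Finset.range n, S j m * I (L - j) (n - m) * w (n - m) := by
  choose f hf1 hf2 using fun r => FC_exists hL r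
  rw [← Finset.sum_fiberwise_of_maps_to (t := Finset.range L) (g := fun r => L - f r)]
  · refine Finset.sum_congr rfl ?_
    intro j hj
    rw [Finset.mem_range] at hj
    rw [← glu_inner_sum w (show (L - j) + j = L by omega) (by omega) n, Finset.filter_filter]
    refine Finset.sum_congr ?_ (fun _ _ => rfl)
    ext r
    simp only [Finset.mem_filter, Finset.mem_univ, true_and]
    refine and_congr_right fun _ => ?_
    have h1 := hf1 r
    constructor
    · intro h
      have : L - j = f r := by omega
      rw [this]
      exact hf2 r
    · intro h
      have := FC_unique r _ _ h (hf2 r)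
      omega
  · intro r _
    have := (hf2 r).1
    simp only [Finset.mem_range]
    omega

/-- The recurrence for the number of irreducible `n`-partitions of `Fin ℓ`. -/
theorem irreducible_partition_recurrence (ℓ n : ℕ) (hℓ : 2 ≤ ℓ) (hn : 1 ≤ n) :
    I ℓ n = S (ℓ - 1) n +
      ∑ j ∈ Finset.range (ℓ - 1), ∑ m ∈ Finset.range (n - 1),
        S j m * I (ℓ - j - 1) (n - m) * (n - m - 1) := by
  classical
  obtain ⟨L, rfl⟩ : ∃ L, ℓ = L + 1 := ⟨ℓ - 1, by omega⟩
  obtain ⟨N, rfl⟩ : ∃ N, n = N + 1 := ⟨n - 1, by omega⟩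
  have hL : 1 ≤ L := by omega
  have hS : S L (N + 1) = ∑ r : Setoid (Fin L) with ncl r = N + 1, 1 := by
    rw [S_eq, Nat.card_eq_fintype_card, Fintype.card_subtype, Finset.card_eq_sum_ones]
  have hA := glu_outer_sum (fun _ => 1) L (N + 1) hL
  have hB := glu_outer_sum (fun x => x) L (N + 1) hL
  simp only [Nat.add_sub_cancel]
  rw [I_succ L _ hL, hB, hS, hA, ← Finset.sum_add_distrib]
  refine Finset.sum_congr rfl fun j hj => ?_
  have hz : ∑ m ∈ Finset.range N, S j m * I (L + 1 - j - 1) (N + 1 - m) * (N + 1 - m - 1) =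
      ∑ m ∈ Finset.range (N + 1), S j m * I (L + 1 - j - 1) (N + 1 - m) * (N + 1 - m - 1) := by
    rw [Finset.sum_range_succ]
    simp
  rw [hz, ← Finset.sum_add_distrib]
  refine Finset.sum_congr rfl fun m hm => ?_
  rw [Finset.mem_range] at hm
  have e1 : L + 1 - j - 1 = L - j := by omega
  rw [e1, ← mul_add]
  congr 1
  omega
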